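/- arXiv:1108.3476 — 3 statements merged into one kernel-verified Lean document; each statement's English description precedes it below -/
import Mathlib

section
/- For every sample x = (x₁,…,xₙ) ∈ Hⁿ, the empirical Rademacher complexity satisfies 𝓡_𝓜(x) ≤ (2^{3/2}/n) · √(sup_{M∈𝓜} Σ_{i=1}^n ‖M x_i‖²) · ( 2 + √( ln ( Σ_{M∈𝓜} (Σ_i ‖M x_i‖²) / (sup_{N∈𝓜} Σ_j ‖N x_j‖²) ) ) ). -/
open scoped ENNReal NNReal RealInnerProductSpace
open MeasureTheory ProbabilityTheory

/-- The infimum-convolution norm `‖β‖_𝓜` (with value `∞` outside `ℓ₁(𝓜)`). -/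
noncomputable def Mnorm {H : Type*} [NormedAddCommGroup H] [InnerProductSpace ℝ H]
    (𝓜 : Set (H →L[ℝ] H)) (β : H) : ℝ≥0∞ :=
  ⨅ v : {v : ↥𝓜 → H // HasSum (fun M : ↥𝓜 => (M : H →L[ℝ] H) (v M)) β},
    ∑' M : ↥𝓜, (‖v.1 M‖₊ : ℝ≥0∞)

/-- The empirical Rademacher complexity `𝓡_𝓜(x)`, with the expectation over the
Rademacher variables written as a uniform average over sign patterns. -/
noncomputable def radComp {H : Type*} [NormedAddCommGroup H] [InnerProductSpace ℝ H]
    (𝓜 : Set (H →L[ℝ] H)) {n : ℕ} (x : Fin n → H) : ℝ :=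
  (2 / n) * ((∑ σ : Fin n → Bool,
    sSup {r : ℝ | ∃ β : H, Mnorm 𝓜 β ≤ 1 ∧
      r = ∑ i, (if σ i then (1 : ℝ) else -1) * ⟪β, x i⟫}) / 2 ^ n)

theorem ConvexOn.add_le_add_of_add_eq {s : Set ℝ} {f : ℝ → ℝ} (hf : ConvexOn ℝ s f)
    {a b u v : ℝ} (ha : a ∈ s) (hb : b ∈ s) (hau : a ≤ u) (hub : u ≤ b)
    (h : u + v = a + b) : f u + f v ≤ f a + f b := by
  rcases hau.eq_or_lt with rfl | hau
  · have : v = b := by linarith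
    rw [this]
  have hab : 0 < b - a := by linarith
  obtain ⟨t, ht⟩ : ∃ t, t = (u - a) / (b - a) := ⟨_, rfl⟩
  have ht0 : 0 ≤ t := by rw [ht]; apply div_nonneg <;> linarith
  have ht1 : t ≤ 1 := by rw [ht, div_le_one hab]; linarith
  have htu : t * (b - a) = u - a := by rw [ht]; field_simp
  have h1 := hf.2 ha hb (sub_nonneg.2 ht1) ht0 (by ring)
  have h2 := hf.2 ha hb ht0 (sub_nonneg.2 ht1) (by ring)
  simp only [smul_eq_mul] at h1 h2
  have e1 : (1 - t) * a + t * b = u := by linarith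
  have e2 : t * a + (1 - t) * b = v := by linarith
  rw [e1] at h1
  rw [e2] at h2
  linarith

section Hilbert

variable {H : Type*} [NormedAddCommGroup H] [InnerProductSpace ℝ H]

theorem cosh_norm_add_add_cosh_norm_sub_le (s y : H) :
    Real.cosh ‖s + y‖ + Real.cosh ‖s - y‖ ≤ 2 * (Real.cosh ‖s‖ * Real.cosh ‖y‖) := by
  have hR : 2 * (Real.cosh ‖s‖ * Real.cosh ‖y‖)
      = Real.cosh (‖s‖ - ‖y‖) + Real.cosh (‖s‖ + ‖y‖) := by
    rw [Real.cosh_add, Real.cosh_sub]; ring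
  rw [hR]
  refine hasSum_le (fun k => ?_) ((Real.hasSum_cosh _).add (Real.hasSum_cosh _))
    ((Real.hasSum_cosh _).add (Real.hasSum_cosh _))
  rw [← add_div, ← add_div]
  refine div_le_div_of_nonneg_right ?_ (Nat.cast_nonneg _)
  simp only [pow_mul]
  refine (convexOn_pow k).add_le_add_of_add_eq (Set.mem_Ici.2 (sq_nonneg _))
    (Set.mem_Ici.2 (sq_nonneg _)) ?_ ?_ ?_
  · rw [sq_le_sq, abs_norm]
    simpa using abs_norm_sub_norm_le s (-y)
  · gcongr
    exact norm_add_le s y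
  · have := parallelogram_law_with_norm ℝ s y
    linarith

theorem sum_cosh_norm_add_signed_sum_le {n : ℕ} (s : H) (y : Fin n → H) :
    ∑ σ : Fin n → Bool, Real.cosh ‖s + ∑ i, (if σ i then (1 : ℝ) else -1) • y i‖
      ≤ 2 ^ n * (Real.cosh ‖s‖ * ∏ i, Real.cosh ‖y i‖) := by
  induction n generalizing s with
  | zero => simp
  | succ n ih =>
    rw [← (Fin.consEquiv fun _ : Fin (n + 1) => Bool).sum_comp, Fintype.sum_prod_type]
    simp only [Fin.consEquiv_apply, Fin.sum_univ_succ, Fin.cons_zero, Fin.cons_succ,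
      Fintype.sum_bool, Fin.prod_univ_succ, if_true, Bool.false_eq_true, if_false, one_smul,
      neg_smul, ← add_assoc, ← sub_eq_add_neg]
    have hP : 0 ≤ ∏ i : Fin n, Real.cosh ‖y i.succ‖ :=
      Finset.prod_nonneg fun i _ => (Real.cosh_pos _).le
    calc _ ≤ 2 ^ n * (Real.cosh ‖s + y 0‖ * ∏ i : Fin n, Real.cosh ‖y i.succ‖)
          + 2 ^ n * (Real.cosh ‖s - y 0‖ * ∏ i : Fin n, Real.cosh ‖y i.succ‖) :=
        add_le_add (ih _ _) (ih _ _)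
      _ = 2 ^ n * ((Real.cosh ‖s + y 0‖ + Real.cosh ‖s - y 0‖)
          * ∏ i : Fin n, Real.cosh ‖y i.succ‖) := by ring
      _ ≤ 2 ^ n * (2 * (Real.cosh ‖s‖ * Real.cosh ‖y 0‖)
          * ∏ i : Fin n, Real.cosh ‖y i.succ‖) := by
        gcongr
        exact cosh_norm_add_add_cosh_norm_sub_le _ _
      _ = _ := by ring

theorem sum_cosh_mul_norm_signed_sum_le {n : ℕ} (y : Fin n → H) (l : ℝ) :
    ∑ σ : Fin n → Bool, Real.cosh (l * ‖∑ i, (if σ i then (1 : ℝ) else -1) • y i‖)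
      ≤ 2 ^ n * Real.exp (l ^ 2 / 2 * ∑ i, ‖y i‖ ^ 2) := by
  have h := sum_cosh_norm_add_signed_sum_le 0 fun i => l • y i
  simp only [zero_add, norm_zero, Real.cosh_zero, one_mul] at h
  calc _ = ∑ σ : Fin n → Bool,
        Real.cosh ‖∑ i, (if σ i then (1 : ℝ) else -1) • l • y i‖ := by
        refine Finset.sum_congr rfl fun σ _ => ?_
        rw [← Real.cosh_abs, abs_mul, abs_norm, ← Real.norm_eq_abs l, ← norm_smul,
          Finset.smul_sum]
        simp only [smul_comm l]
    _ ≤ _ := h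
    _ ≤ _ := by
      gcongr
      rw [Finset.mul_sum, Real.exp_sum]
      gcongr with i
      refine (Real.cosh_le_exp_half_sq _).trans (le_of_eq ?_)
      rw [norm_smul, mul_pow, Real.norm_eq_abs, sq_abs]
      ring_nf

theorem exp_mul_sub_one_le {c t : ℝ} (h0 : 0 ≤ t) (h1 : t ≤ 1) :
    Real.exp (c * t) - 1 ≤ t * (Real.exp c - 1) := by
  have h := convexOn_exp.2 (Set.mem_univ 0) (Set.mem_univ c) (sub_nonneg.2 h1) h0 (by ring)
  simp only [smul_eq_mul, mul_zero, zero_add, Real.exp_zero, mul_one] at h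
  rw [mul_comm c t]
  linarith

/-- A random selection from a family of Rademacher sums with total variance at most `T` and
individual variances at most `S` has exponential moments controlled by `T / S`. -/
theorem sum_cosh_selection_le {ι : Type*} {n : ℕ} (y : ι → Fin n → H) {S T : ℝ}
    (hS : 0 < S) (hST : S ≤ T) (hyS : ∀ j, ∑ i, ‖y j i‖ ^ 2 ≤ S)
    (hyT : ∀ A : Finset ι, ∑ j ∈ A, ∑ i, ‖y j i‖ ^ 2 ≤ T) (g : (Fin n → Bool) → ι) (l : ℝ) :
    ∑ σ, Real.cosh (l * ‖∑ i, (if σ i then (1 : ℝ) else -1) • y (g σ) i‖)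
      ≤ 2 ^ n * (T / S * Real.exp (l ^ 2 / 2 * S)) := by
  classical
  set F : ι → (Fin n → Bool) → ℝ := fun j σ =>
    Real.cosh (l * ‖∑ i, (if σ i then (1 : ℝ) else -1) • y j i‖) - 1 with hF
  have hF0 : ∀ j σ, 0 ≤ F j σ := fun j σ => sub_nonneg.2 (Real.one_le_cosh _)
  have hcard : ∑ _σ : Fin n → Bool, (1 : ℝ) = 2 ^ n := by simp
  have hE : 0 ≤ Real.exp (l ^ 2 / 2 * S) - 1 := by
    rw [sub_nonneg, Real.one_le_exp_iff]; positivity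
  have hone : ∀ j, ∑ σ, F j σ
      ≤ 2 ^ n * ((∑ i, ‖y j i‖ ^ 2) / S * (Real.exp (l ^ 2 / 2 * S) - 1)) := by
    intro j
    have h1 := sum_cosh_mul_norm_signed_sum_le (y j) l
    have h2 := exp_mul_sub_one_le (c := l ^ 2 / 2 * S) (t := (∑ i, ‖y j i‖ ^ 2) / S)
      (by positivity) ((div_le_one hS).2 (hyS j))
    have h3 : l ^ 2 / 2 * S * ((∑ i, ‖y j i‖ ^ 2) / S) = l ^ 2 / 2 * ∑ i, ‖y j i‖ ^ 2 := by
      field_simp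
    rw [h3] at h2
    rw [hF, Finset.sum_sub_distrib, hcard]
    calc _ ≤ (2 : ℝ) ^ n * (Real.exp (l ^ 2 / 2 * ∑ i, ‖y j i‖ ^ 2) - 1) := by linarith
      _ ≤ _ := by gcongr
  have hsel : ∑ σ, F (g σ) σ ≤ 2 ^ n * (T / S * (Real.exp (l ^ 2 / 2 * S) - 1)) :=
    calc ∑ σ, F (g σ) σ ≤ ∑ σ, ∑ j ∈ Finset.univ.image g, F j σ :=
          Finset.sum_le_sum fun σ _ => Finset.single_le_sum (f := fun j => F j σ)
            (fun j _ => hF0 j σ) (Finset.mem_image_of_mem g (Finset.mem_univ σ))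
      _ = ∑ j ∈ Finset.univ.image g, ∑ σ, F j σ := Finset.sum_comm
      _ ≤ ∑ j ∈ Finset.univ.image g,
            2 ^ n * ((∑ i, ‖y j i‖ ^ 2) / S * (Real.exp (l ^ 2 / 2 * S) - 1)) :=
          Finset.sum_le_sum fun j _ => hone j
      _ = 2 ^ n * ((∑ j ∈ Finset.univ.image g, ∑ i, ‖y j i‖ ^ 2) / S
            * (Real.exp (l ^ 2 / 2 * S) - 1)) := by
          rw [← Finset.mul_sum, ← Finset.sum_mul, ← Finset.sum_div]
      _ ≤ _ := by gcongr; exact hyT _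
  rw [hF, Finset.sum_sub_distrib, hcard] at hsel
  have h1 : 1 ≤ T / S := (one_le_div hS).2 hST
  have h2 : (2 : ℝ) ^ n * 1 ≤ 2 ^ n * (T / S) := by gcongr
  linarith

theorem sum_norm_selection_le {ι : Type*} {n : ℕ} (y : ι → Fin n → H) {S T : ℝ}
    (hS : 0 < S) (hST : S ≤ T) (hyS : ∀ j, ∑ i, ‖y j i‖ ^ 2 ≤ S)
    (hyT : ∀ A : Finset ι, ∑ j ∈ A, ∑ i, ‖y j i‖ ^ 2 ≤ T) (g : (Fin n → Bool) → ι) :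
    ∑ σ, ‖∑ i, (if σ i then (1 : ℝ) else -1) • y (g σ) i‖
      ≤ 2 ^ n * (√2 * √S * (2 + √(Real.log (T / S)))) := by
  set F : (Fin n → Bool) → ℝ := fun σ =>
    ‖∑ i, (if σ i then (1 : ℝ) else -1) • y (g σ) i‖
  set L := Real.log (T / S) with hL
  set ρ := 2 + √L with hρ
  have h1 : 1 ≤ T / S := (one_le_div hS).2 hST
  have hL0 : 0 ≤ L := Real.log_nonneg h1
  have hρ0 : 0 < ρ := by positivity
  have hsS : 0 < √S := Real.sqrt_pos.2 hS
  set l := √2 * ρ / √S with hl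
  have hl0 : 0 < l := by positivity
  have hlS : l ^ 2 / 2 * S = ρ ^ 2 := by
    rw [hl, div_pow, mul_pow, Real.sq_sqrt hS.le, Real.sq_sqrt zero_le_two]
    field_simp
  have hc := sum_cosh_selection_le y hS hST hyS hyT g l
  rw [hlS] at hc
  obtain ⟨K, hK⟩ : ∃ K, K = 1 + L + ρ ^ 2 := ⟨_, rfl⟩
  have hexpK : Real.exp K = Real.exp 1 * (T / S * Real.exp (ρ ^ 2)) := by
    rw [hK, Real.exp_add, Real.exp_add, hL, Real.exp_log (by linarith), mul_assoc]
  have hpt : ∀ σ, l * F σ ≤ (K - 1) + 2 * Real.exp (-K) * Real.cosh (l * F σ) := by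
    intro σ
    have h2 := Real.add_one_le_exp (l * F σ - K)
    have h3 : Real.exp (l * F σ - K) ≤ 2 * Real.exp (-K) * Real.cosh (l * F σ) := by
      rw [sub_eq_add_neg, Real.exp_add, Real.cosh_eq]
      have := mul_pos (Real.exp_pos (-K)) (Real.exp_pos (-(l * F σ)))
      nlinarith
    linarith
  have hsum : l * ∑ σ, F σ ≤ 2 ^ n * K := by
    calc l * ∑ σ, F σ = ∑ σ, l * F σ := Finset.mul_sum ..
      _ ≤ ∑ σ, ((K - 1) + 2 * Real.exp (-K) * Real.cosh (l * F σ)) :=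
          Finset.sum_le_sum fun σ _ => hpt σ
      _ = 2 ^ n * (K - 1) + 2 * Real.exp (-K) * ∑ σ, Real.cosh (l * F σ) := by
          rw [Finset.sum_add_distrib, ← Finset.mul_sum]; simp [mul_sub]
      _ ≤ 2 ^ n * (K - 1)
            + 2 * Real.exp (-K) * (2 ^ n * (T / S * Real.exp (ρ ^ 2))) := by gcongr
      _ = 2 ^ n * (K - 1 + 2 / Real.exp 1) := by
          rw [Real.exp_neg, hexpK]
          have hT : 0 < T := hS.trans_le hST
          field_simp
      _ ≤ 2 ^ n * K := by
          gcongr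
          have h4 : 2 / Real.exp 1 ≤ 1 := by
            rw [div_le_one (Real.exp_pos 1)]
            linarith [Real.add_one_le_exp (1 : ℝ)]
          linarith
  have hK2 : K ≤ 2 * ρ ^ 2 := by
    have := Real.sq_sqrt hL0
    have := Real.sqrt_nonneg L
    rw [hK, hρ]
    nlinarith
  refine le_of_mul_le_mul_left (hsum.trans ?_) hl0
  have hR : l * (2 ^ n * (√2 * √S * ρ)) = 2 ^ n * (2 * ρ ^ 2) := by
    rw [hl]
    field_simp
    rw [Real.sq_sqrt zero_le_two]
  rw [hR]
  gcongr

theorem inner_le_of_Mnorm_le_one {𝓜 : Set (H →L[ℝ] H)}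
    (hsym : ∀ M ∈ 𝓜, ∀ x y : H, ⟪M x, y⟫ = ⟪x, M y⟫) {β w : H} (hβ : Mnorm 𝓜 β ≤ 1)
    {Y : ℝ} (hY : 0 ≤ Y) (hw : ∀ M ∈ 𝓜, ‖M w‖ ≤ Y) : ⟪β, w⟫ ≤ Y := by
  refine le_of_forall_pos_le_add fun δ hδ => ?_
  have hη : 0 < δ / (Y + 1) := by positivity
  have hlt : Mnorm 𝓜 β < ENNReal.ofReal (1 + δ / (Y + 1)) := by
    refine hβ.trans_lt ?_
    rw [ENNReal.one_lt_ofReal]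
    linarith
  obtain ⟨⟨v, hv⟩, hlt⟩ := iInf_lt_iff.1 hlt
  have hne : ∑' M : ↥𝓜, (‖v M‖₊ : ℝ≥0∞) ≠ ⊤ := hlt.ne_top
  have hsv : Summable fun M : ↥𝓜 => ‖v M‖ :=
    NNReal.summable_coe.2 (ENNReal.tsum_coe_ne_top_iff_summable.1 hne)
  have hle : ∑' M : ↥𝓜, ‖v M‖ ≤ 1 + δ / (Y + 1) := by
    have h1 := ENNReal.toReal_mono ENNReal.ofReal_ne_top hlt.le
    rw [ENNReal.toReal_ofReal (by positivity), ENNReal.tsum_toReal_eq (by simp)] at h1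
    simpa using h1
  have hin := (innerSL ℝ w).hasSum hv
  have hβw : ⟪β, w⟫ ≤ (∑' M : ↥𝓜, ‖v M‖) * Y := by
    rw [real_inner_comm]
    refine hasSum_le (fun M => ?_) hin (hsv.hasSum.mul_right Y)
    rw [innerSL_apply_apply, real_inner_comm, hsym M M.2]
    refine (real_inner_le_norm _ _).trans ?_
    gcongr
    exact hw M M.2
  calc ⟪β, w⟫ ≤ (1 + δ / (Y + 1)) * Y := hβw.trans (by gcongr)
    _ = Y + δ * (Y / (Y + 1)) := by ring
    _ ≤ Y + δ := by
      gcongr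
      refine mul_le_of_le_one_right hδ.le ?_
      rw [div_le_one (by positivity)]
      linarith

theorem radComp_le {𝓜 : Set (H →L[ℝ] H)}
    (hsym : ∀ M ∈ 𝓜, ∀ x y : H, ⟪M x, y⟫ = ⟪x, M y⟫) {n : ℕ} (x : Fin n → H)
    (Y : (Fin n → Bool) → ℝ) (hY : ∀ σ, 0 ≤ Y σ)
    (hw : ∀ σ, ∀ M ∈ 𝓜, ‖∑ i, (if σ i then (1 : ℝ) else -1) • M (x i)‖ ≤ Y σ) :
    radComp 𝓜 x ≤ (2 / n) * ((∑ σ, Y σ) / 2 ^ n) := by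
  unfold radComp
  gcongr with σ
  refine Real.sSup_le ?_ (hY σ)
  rintro r ⟨β, hβ, rfl⟩
  have h := inner_le_of_Mnorm_le_one hsym
    (w := ∑ i, (if σ i then (1 : ℝ) else -1) • x i) hβ (hY σ) fun M hM => by
      simpa only [map_sum, map_smul] using hw σ M hM
  simpa only [inner_sum, inner_smul_right] using h

theorem norm_signed_sum_le {n : ℕ} (y : Fin n → H) (σ : Fin n → Bool) {S : ℝ}
    (h : ∑ i, ‖y i‖ ^ 2 ≤ S) :
    ‖∑ i, (if σ i then (1 : ℝ) else -1) • y i‖ ≤ n * √S := by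
  calc _ ≤ ∑ _i : Fin n, √S := by
        refine norm_sum_le_of_le _ fun i _ => ?_
        have h1 : ‖(if σ i then (1 : ℝ) else -1) • y i‖ = ‖y i‖ := by
          split_ifs <;> simp
        rw [h1]
        refine Real.le_sqrt_of_sq_le (le_trans ?_ h)
        exact Finset.single_le_sum (f := fun i => ‖y i‖ ^ 2) (fun i _ => sq_nonneg _)
          (Finset.mem_univ i)
    _ = _ := by simp

end Hilbert

/-- Theorem 2 (main theorem), first inequality: data-dependent bound on the
empirical Rademacher complexity. -/
theorem rademacher_main_bound
    {H : Type*} [NormedAddCommGroup H] [InnerProductSpace ℝ H] [CompleteSpace H]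
    (𝓜 : Set (H →L[ℝ] H)) [Countable ↥𝓜]
    (hsym : ∀ M ∈ 𝓜, ∀ x y : H, ⟪M x, y⟫ = ⟪x, M y⟫)
    (hnondeg : ∀ x : H, x ≠ 0 → ∃ M ∈ 𝓜, M x ≠ 0)
    (C₀ : ℝ) (hbdd : ∀ M ∈ 𝓜, ‖M‖ ≤ C₀)
    {n : ℕ} (hn : 0 < n) (x : Fin n → H)
    (hsum : Summable fun M : ↥𝓜 => ∑ i, ‖(M : H →L[ℝ] H) (x i)‖ ^ 2) :
    radComp 𝓜 x ≤
      (2 ^ ((3 : ℝ) / 2) / n) *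
        Real.sqrt (⨆ M : ↥𝓜, ∑ i, ‖(M : H →L[ℝ] H) (x i)‖ ^ 2) *
        (2 + Real.sqrt (Real.log
          ((∑' M : ↥𝓜, ∑ i, ‖(M : H →L[ℝ] H) (x i)‖ ^ 2) /
            (⨆ N : ↥𝓜, ∑ j, ‖(N : H →L[ℝ] H) (x j)‖ ^ 2)))) := by
  set V : ↥𝓜 → ℝ := fun M => ∑ i, ‖(M : H →L[ℝ] H) (x i)‖ ^ 2 with hV
  have hV0 : ∀ M, 0 ≤ V M := fun M => by positivity
  have hVT : ∀ M, V M ≤ ∑' M, V M := fun M => hsum.le_tsum M fun N _ => hV0 N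
  have hbd : BddAbove (Set.range V) := ⟨_, Set.forall_mem_range.2 hVT⟩
  set S := ⨆ M, V M
  set T := ∑' M, V M
  have hVS : ∀ M, V M ≤ S := le_ciSup hbd
  have hS0 : 0 ≤ S := Real.iSup_nonneg hV0
  have hbdY : ∀ σ : Fin n → Bool, ∀ M : ↥𝓜,
      ‖∑ i, (if σ i then (1 : ℝ) else -1) • (M : H →L[ℝ] H) (x i)‖ ≤ n * √S :=
    fun σ M => norm_signed_sum_le _ σ (hVS M)
  rcases hS0.eq_or_lt with hS | hS
  · rw [← hS] at hbdY ⊢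
    refine (radComp_le hsym x (fun _ => 0) (fun _ => le_rfl) fun σ M hM => ?_).trans ?_
    · simpa using hbdY σ ⟨M, hM⟩
    · simp
  have hne : Nonempty ↥𝓜 := by
    by_contra hempty
    rw [not_nonempty_iff] at hempty
    exact hS.ne' (Real.iSup_of_isEmpty V)
  have hST : S ≤ T := ciSup_le hVT
  set Y : (Fin n → Bool) → ℝ := fun σ =>
    ⨆ M : ↥𝓜, ‖∑ i, (if σ i then (1 : ℝ) else -1) • (M : H →L[ℝ] H) (x i)‖ with hY
  have hle := radComp_le hsym x Y (fun σ => Real.iSup_nonneg fun M => norm_nonneg _)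
    fun σ M hM => le_ciSup (f := fun M : ↥𝓜 =>
      ‖∑ i, (if σ i then (1 : ℝ) else -1) • (M : H →L[ℝ] H) (x i)‖)
      ⟨_, Set.forall_mem_range.2 (hbdY σ)⟩ ⟨M, hM⟩
  have hmean : (∑ σ, Y σ) / 2 ^ n ≤ √2 * √S * (2 + √(Real.log (T / S))) := by
    refine le_of_forall_pos_le_add fun δ hδ => ?_
    have hex : ∀ σ, ∃ M : ↥𝓜, Y σ - δ <
        ‖∑ i, (if σ i then (1 : ℝ) else -1) • (M : H →L[ℝ] H) (x i)‖ :=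
      fun σ => exists_lt_of_lt_ciSup (sub_lt_self (Y σ) hδ)
    choose g hg using hex
    have hsel := sum_norm_selection_le (fun (M : ↥𝓜) i => (M : H →L[ℝ] H) (x i)) hS hST hVS
      (fun A => hsum.sum_le_tsum A fun M _ => hV0 M) g
    have hlow := (Finset.sum_le_sum fun σ (_ : σ ∈ Finset.univ) => (hg σ).le).trans hsel
    rw [Finset.sum_sub_distrib] at hlow
    simp only [Finset.sum_const, Finset.card_univ, Fintype.card_fun, Fintype.card_bool,
      Fintype.card_fin, nsmul_eq_mul, Nat.cast_pow, Nat.cast_ofNat] at hlow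
    rw [div_le_iff₀ (by positivity)]
    linarith
  have h232 : (2 : ℝ) ^ ((3 : ℝ) / 2) = 2 * √2 := by
    rw [Real.sqrt_eq_rpow, show (3 : ℝ) / 2 = 1 + 1 / 2 by norm_num,
      Real.rpow_add zero_lt_two, Real.rpow_one]
  calc radComp 𝓜 x ≤ 2 / n * ((∑ σ, Y σ) / 2 ^ n) := hle
    _ ≤ 2 / n * (√2 * √S * (2 + √(Real.log (T / S)))) := by gcongr
    _ = _ := by rw [h232]; ring
end

section
/- For every z ∈ H, the linear functional β ↦ ⟨β, z⟩ is bounded on the normed space (ℓ₁(𝓜), ‖·‖_𝓜), and its operator norm equals ‖z‖_{𝓜*} = sup_{M∈𝓜} ‖Mz‖. -/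
open scoped ENNReal NNReal RealInnerProductSpace
open MeasureTheory ProbabilityTheory

/-- Hölder-type bound: pairing with `z` is controlled by `sup_M ‖M z‖` times `‖β‖_𝓜`. -/
theorem enorm_inner_le_mul_Mnorm {H : Type*} [NormedAddCommGroup H] [InnerProductSpace ℝ H]
    {𝓜 : Set (H →L[ℝ] H)} (hsym : ∀ M ∈ 𝓜, ∀ x y : H, ⟪M x, y⟫ = ⟪x, M y⟫)
    {z : H} {D : ℝ} (hD : ∀ M ∈ 𝓜, ‖M z‖ ≤ D) {β : H} (hβ : Mnorm 𝓜 β < ⊤) :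
    ‖⟪β, z⟫‖ₑ ≤ ENNReal.ofReal D * Mnorm 𝓜 β := by
  have hne : Nonempty {v : ↥𝓜 → H // HasSum (fun M : ↥𝓜 => (M : H →L[ℝ] H) (v M)) β} := by
    by_contra h
    rw [not_nonempty_iff] at h
    simp [Mnorm] at hβ
  rw [Mnorm, ENNReal.mul_iInf' (by simp) (fun _ => hne)]
  refine le_iInf fun v => ?_
  have hsum : HasSum (fun M : ↥𝓜 => ⟪v.1 M, (M : H →L[ℝ] H) z⟫) ⟪β, z⟫ := by
    have h : HasSum (fun M : ↥𝓜 => ⟪z, (M : H →L[ℝ] H) (v.1 M)⟫) ⟪z, β⟫ :=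
      v.2.mapL (innerSL ℝ z)
    rw [real_inner_comm]
    exact (funext fun M : ↥𝓜 => by rw [← hsym M M.2, real_inner_comm] :
      (fun M : ↥𝓜 => ⟪v.1 M, (M : H →L[ℝ] H) z⟫) = _) ▸ h
  rw [← hsum.tsum_eq, ← ENNReal.tsum_mul_left]
  refine enorm_tsum_le_tsum_enorm.trans (ENNReal.tsum_le_tsum fun M => ?_)
  rw [mul_comm, ← enorm_eq_nnnorm, ← ofReal_norm, ← ofReal_norm,
    ← ENNReal.ofReal_mul (norm_nonneg _)]
  exact ENNReal.ofReal_le_ofReal ((norm_inner_le_norm _ _).trans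
    (mul_le_mul_of_nonneg_left (hD M M.2) (norm_nonneg _)))

/-- A vector in the range of a single `M ∈ 𝓜` has `‖M w‖_𝓜 ≤ ‖w‖`. -/
theorem Mnorm_apply_le {H : Type*} [NormedAddCommGroup H] [InnerProductSpace ℝ H]
    {𝓜 : Set (H →L[ℝ] H)} (M : ↥𝓜) (w : H) :
    Mnorm 𝓜 ((M : H →L[ℝ] H) w) ≤ ‖w‖ₑ := by
  classical
  have hsum : HasSum (fun N : ↥𝓜 => (N : H →L[ℝ] H) (Pi.single (M := fun _ => H) M w N))
      ((M : H →L[ℝ] H) w) := by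
    convert hasSum_single M fun N hN => ?_ using 1
    · simp
    · simp [Pi.single_eq_of_ne hN]
  refine (iInf_le _ ⟨_, hsum⟩).trans (le_of_eq ?_)
  rw [tsum_eq_single M fun N hN => by simp [Pi.single_eq_of_ne hN]]
  simp [enorm_eq_nnnorm]

/-- Theorem 7 (duality): for every `z ∈ H` the linear functional `β ↦ ⟪β, z⟫` is
bounded on `(ℓ₁(𝓜), ‖·‖_𝓜)` and its operator norm equals
`‖z‖_{𝓜*} = sup_{M ∈ 𝓜} ‖M z‖`. -/
theorem Mnorm_dual_norm
    {H : Type*} [NormedAddCommGroup H] [InnerProductSpace ℝ H] [CompleteSpace H]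
    (𝓜 : Set (H →L[ℝ] H)) [Countable ↥𝓜]
    (hsym : ∀ M ∈ 𝓜, ∀ x y : H, ⟪M x, y⟫ = ⟪x, M y⟫)
    (hnondeg : ∀ x : H, x ≠ 0 → ∃ M ∈ 𝓜, M x ≠ 0)
    (C₀ : ℝ) (hbdd : ∀ M ∈ 𝓜, ‖M‖ ≤ C₀)
    (z : H) :
    (∀ β : H, Mnorm 𝓜 β < ⊤ →
        |⟪β, z⟫| ≤ (⨆ M : ↥𝓜, ‖(M : H →L[ℝ] H) z‖) * (Mnorm 𝓜 β).toReal) ∧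
    (∀ c : ℝ, 0 ≤ c →
        (∀ β : H, Mnorm 𝓜 β < ⊤ → |⟪β, z⟫| ≤ c * (Mnorm 𝓜 β).toReal) →
        (⨆ M : ↥𝓜, ‖(M : H →L[ℝ] H) z‖) ≤ c) := by
  have hle : ∀ M ∈ 𝓜, ‖M z‖ ≤ ⨆ M : ↥𝓜, ‖(M : H →L[ℝ] H) z‖ := fun M hM =>
    le_ciSup (f := fun M : ↥𝓜 => ‖(M : H →L[ℝ] H) z‖)
      ⟨C₀ * ‖z‖, by rintro _ ⟨N, rfl⟩; exact N.1.le_of_opNorm_le (hbdd N N.2) z⟩ ⟨M, hM⟩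
  refine ⟨fun β hβ => ?_, fun c hc h => Real.iSup_le (fun M => ?_) hc⟩
  · have h := ENNReal.toReal_mono (ENNReal.mul_ne_top ENNReal.ofReal_ne_top hβ.ne)
      (enorm_inner_le_mul_Mnorm hsym hle hβ)
    rwa [ENNReal.toReal_mul, toReal_enorm, Real.norm_eq_abs,
      ENNReal.toReal_ofReal (Real.iSup_nonneg fun _ => norm_nonneg _)] at h
  · have hM := Mnorm_apply_le M ((M : H →L[ℝ] H) z)
    have hβ := h _ (hM.trans_lt enorm_lt_top)
    rw [hsym M M.2, real_inner_self_eq_norm_sq, abs_of_nonneg (sq_nonneg _)] at hβ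
    have hnorm := ENNReal.toReal_mono enorm_ne_top hM
    rw [toReal_enorm] at hnorm
    rcases (norm_nonneg ((M : H →L[ℝ] H) z)).eq_or_lt with h0 | h0
    · rwa [← h0]
    · refine le_of_mul_le_mul_right ?_ h0
      rw [← sq]
      exact hβ.trans (mul_le_mul_of_nonneg_left hnorm hc)
end

section
/- If the ranges of the members of 𝓜 are mutually orthogonal, then for every β ∈ ℓ₁(𝓜) one has ‖β‖_𝓜 = Σ_{M∈𝓜} ‖M⁺β‖, where M⁺ denotes the (Moore–Penrose) pseudoinverse of M. -/
open scoped ENNReal NNReal RealInnerProductSpace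
open MeasureTheory ProbabilityTheory

/-- A symmetric idempotent map on a real inner product space is norm-nonincreasing. -/
theorem norm_apply_le_of_symmetric_of_idempotent
    {H : Type*} [NormedAddCommGroup H] [InnerProductSpace ℝ H] {Q : H → H}
    (hQsym : ∀ u v : H, ⟪Q u, v⟫ = ⟪u, Q v⟫) (hQ : ∀ u : H, Q (Q u) = Q u) (v : H) :
    ‖Q v‖ ≤ ‖v‖ := by
  have h : ‖Q v‖ * ‖Q v‖ ≤ ‖v‖ * ‖Q v‖ := by
    rw [← real_inner_self_eq_norm_mul_norm, hQsym, hQ]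
    exact real_inner_le_norm _ _
  rcases (norm_nonneg (Q v)).eq_or_lt with h0 | h0
  · rw [← h0]
    exact norm_nonneg v
  · exact le_of_mul_le_mul_right h h0

/-- A pseudoinverse of `N` kills every vector orthogonal to the range of `N`. -/
theorem pseudoinverse_apply_eq_zero_of_orthogonal
    {H : Type*} [NormedAddCommGroup H] [InnerProductSpace ℝ H] {N P : H →L[ℝ] H}
    (hPNP : ∀ u : H, P (N (P u)) = P u) (hNP : ∀ u v : H, ⟪N (P u), v⟫ = ⟪u, N (P v)⟫)
    {x : H} (hx : ∀ w : H, ⟪x, N w⟫ = 0) : P x = 0 := by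
  have h : N (P x) = 0 := ext_inner_right ℝ fun w => by
    rw [hNP, hx, inner_zero_left]
  rw [← hPNP, h, map_zero]

/-- Proposition 8: if the ranges of the members of `𝓜` are mutually orthogonal then
`‖β‖_𝓜 = Σ_{M ∈ 𝓜} ‖M⁺ β‖` for every `β ∈ ℓ₁(𝓜)`, where the Moore–Penrose
pseudoinverse `M⁺` of `M` is encoded by a map `P` satisfying the four Penrose axioms
(self-adjointness of `M P M` and `P M M` being expressed via the inner product, since
the operators are symmetric). -/
theorem Mnorm_eq_tsum_pseudoinverse
    {H : Type*} [NormedAddCommGroup H] [InnerProductSpace ℝ H] [CompleteSpace H]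
    (𝓜 : Set (H →L[ℝ] H)) [Countable ↥𝓜]
    (hsym : ∀ M ∈ 𝓜, ∀ x y : H, ⟪M x, y⟫ = ⟪x, M y⟫)
    (hnondeg : ∀ x : H, x ≠ 0 → ∃ M ∈ 𝓜, M x ≠ 0)
    (C₀ : ℝ) (hbdd : ∀ M ∈ 𝓜, ‖M‖ ≤ C₀)
    (horth : ∀ M N : ↥𝓜, M ≠ N → ∀ u v : H,
        ⟪(M : H →L[ℝ] H) u, (N : H →L[ℝ] H) v⟫ = 0)
    (P : ↥𝓜 → H →L[ℝ] H)
    (hP1 : ∀ M : ↥𝓜, ∀ u : H,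
        (M : H →L[ℝ] H) (P M ((M : H →L[ℝ] H) u)) = (M : H →L[ℝ] H) u)
    (hP2 : ∀ M : ↥𝓜, ∀ u : H, P M ((M : H →L[ℝ] H) (P M u)) = P M u)
    (hP3 : ∀ M : ↥𝓜, ∀ u v : H,
        ⟪(M : H →L[ℝ] H) (P M u), v⟫ = ⟪u, (M : H →L[ℝ] H) (P M v)⟫)
    (hP4 : ∀ M : ↥𝓜, ∀ u v : H,
        ⟪P M ((M : H →L[ℝ] H) u), v⟫ = ⟪u, P M ((M : H →L[ℝ] H) v)⟫)
    (β : H) (hβ : Mnorm 𝓜 β < ⊤) :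
    Mnorm 𝓜 β = ∑' M : ↥𝓜, (‖P M β‖₊ : ℝ≥0∞) := by
  have hPβ : ∀ v : ↥𝓜 → H, HasSum (fun M : ↥𝓜 => (M : H →L[ℝ] H) (v M)) β →
      ∀ N : ↥𝓜, P N β = P N ((N : H →L[ℝ] H) (v N)) := by
    intro v hv N
    refine (hv.mapL (P N)).unique (hasSum_single N fun M hMN => ?_)
    exact pseudoinverse_apply_eq_zero_of_orthogonal (hP2 N) (hP3 N)
      fun w => horth M N hMN (v M) w
  apply le_antisymm
  · obtain ⟨⟨v, hv⟩, -⟩ := iInf_lt_iff.mp hβ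
    have hsum : HasSum (fun M : ↥𝓜 => (M : H →L[ℝ] H) (P M β)) β := by
      simpa only [hPβ v hv, hP1] using hv
    exact iInf_le_of_le ⟨fun M => P M β, hsum⟩ le_rfl
  · refine le_iInf fun ⟨v, hv⟩ => ENNReal.tsum_le_tsum fun N => ?_
    rw [hPβ v hv N, ENNReal.coe_le_coe, ← NNReal.coe_le_coe, coe_nnnorm, coe_nnnorm]
    exact norm_apply_le_of_symmetric_of_idempotent
      (Q := fun u => P N ((N : H →L[ℝ] H) u)) (hP4 N) (fun u => hP2 N _) (v N)
end
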